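/- Let q be a prime power, F a finite field with q elements, and n ≥ 3. There does not exist a Cameron–Liebler line class (Cameron–Liebler 1-set) 𝓛 of AG(n,q) with |𝓛| = 2·[n 1]_q = 2(q^n − 1)/(q − 1), i.e. with parameter x = 2. -/

import Mathlib

open Module

/-- The Gaussian binomial coefficient `[a b]_q`. -/
noncomputable def gaussBinom (q a b : ℕ) : ℚ :=
  ∏ i ∈ Finset.range b, ((q : ℚ) ^ (a - i) - 1) / ((q : ℚ) ^ (i + 1) - 1)

variable {F : Type} [Field F] [Fintype F] {n : ℕ}

/-- `K` is a projective `j`-space of `PG(n,q)`: a submodule of rank `j+1`. -/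
def IsProjSub (j : ℕ) (K : Submodule F (Fin (n + 1) → F)) : Prop :=
  Module.finrank F K = j + 1

/-- `P` is a projective point: a submodule of rank `1`. -/
def IsProjPoint (P : Submodule F (Fin (n + 1) → F)) : Prop :=
  Module.finrank F P = 1

/-- `P` is an affine point w.r.t. the hyperplane at infinity `Hinf`. -/
def IsAffPoint (Hinf P : Submodule F (Fin (n + 1) → F)) : Prop :=
  Module.finrank F P = 1 ∧ ¬ P ≤ Hinf

/-- `K` is an affine `j`-space (a `j`-space of `AG(n,q)`). -/
def IsAffSub (j : ℕ) (Hinf K : Submodule F (Fin (n + 1) → F)) : Prop :=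
  Module.finrank F K = j + 1 ∧ ¬ K ≤ Hinf

/-- `M` is a Cameron–Liebler `k`-set of `PG(n,q)`. -/
def IsCLProj (k : ℕ) (M : Set (Submodule F (Fin (n + 1) → F))) : Prop :=
  (∀ K ∈ M, IsProjSub k K) ∧
  ∃ w : Submodule F (Fin (n + 1) → F) → ℝ,
    ∀ K, IsProjSub k K →
      Set.indicator M (fun _ => (1 : ℝ)) K =
        ∑ᶠ P ∈ {P | IsProjPoint P ∧ P ≤ K}, w P

/-- `L` is a Cameron–Liebler `k`-set of `AG(n,q)`. -/
def IsCLAff (k : ℕ) (Hinf : Submodule F (Fin (n + 1) → F))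
    (L : Set (Submodule F (Fin (n + 1) → F))) : Prop :=
  (∀ K ∈ L, IsAffSub k Hinf K) ∧
  ∃ w : Submodule F (Fin (n + 1) → F) → ℝ,
    ∀ K, IsAffSub k Hinf K →
      Set.indicator L (fun _ => (1 : ℝ)) K =
        ∑ᶠ P ∈ {P | IsAffPoint Hinf P ∧ P ≤ K}, w P

/-- `S` is a `k`-spread of `AG(n,q)`: every affine point is on exactly one member. -/
def IsSpread (k : ℕ) (Hinf : Submodule F (Fin (n + 1) → F))
    (S : Set (Submodule F (Fin (n + 1) → F))) : Prop :=
  (∀ K ∈ S, IsAffSub k Hinf K) ∧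
  ∀ P, IsAffPoint Hinf P → ∃! K, K ∈ S ∧ P ≤ K


theorem exists_functional_eq_one {k E : Type*} [Field k] [AddCommGroup E] [Module k E] {d : E} (hd : d ≠ 0) :
    ∃ ψ : E →ₗ[k] k, ψ d = 1 := by
  obtain ⟨ψ, h⟩ : ∃ ψ : Module.Dual k E, ψ d ≠ 0 := by
    by_contra! h
    exact hd ((Module.forall_dual_apply_eq_zero_iff k d).1 h)
  exact ⟨(ψ d)⁻¹ • ψ, by simp [h]⟩

theorem exists_functional_ker_eq {F : Type*} [Field F] {n : ℕ}
    {Hinf : Submodule F (Fin (n + 1) → F)} (hH : Module.finrank F Hinf = n) :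
    ∃ (φ : (Fin (n + 1) → F) →ₗ[F] F) (e : Fin (n + 1) → F),
      LinearMap.ker φ = Hinf ∧ φ e = 1 := by
  obtain ⟨e, he⟩ : ∃ e, e ∉ Hinf := by
    by_contra! h
    rw [Submodule.eq_top_iff'.2 h, finrank_top, Module.finrank_fin_fun] at hH
    omega
  obtain ⟨φ, hφe, hφ⟩ := Submodule.exists_le_ker_of_notMem he
  have hne : φ ≠ 0 := fun h => hφe (by simp [h])
  refine ⟨(φ e)⁻¹ • φ, e, ?_, by simp [hφe]⟩
  rw [LinearMap.ker_smul _ _ (inv_ne_zero hφe)]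
  refine (Submodule.eq_of_le_of_finrank_le hφ ?_).symm
  have h := LinearMap.finrank_range_add_finrank_ker φ
  rw [LinearMap.range_eq_top.2 (LinearMap.surjective hne), finrank_top, Module.finrank_self,
    Module.finrank_fin_fun] at h
  omega

section LineSums

variable {k E : Type*} [Field k] [Fintype k] [AddCommGroup E] [Module k E] [Fintype E]

/-- The sum of `f` along the affine line through `p` with direction `d`. -/
def lineSum (k : Type*) {E : Type*} [Field k] [Fintype k] [AddCommGroup E] [Module k E]
    (f : E → ℝ) (p d : E) : ℝ :=
  ∑ t : k, f (p + t • d)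

theorem sum_lineSum (f : E → ℝ) (d : E) :
    ∑ p, lineSum k f p d = Fintype.card k * ∑ x, f x := by
  unfold lineSum
  rw [Finset.sum_comm]
  have h : ∀ t : k, ∑ p, f (p + t • d) = ∑ x, f x := fun t =>
    Equiv.sum_comp (Equiv.addRight (t • d)) f
  simp [h]

theorem sum_eq_sum_ker (ψ : E →ₗ[k] k) {e : E} (he : ψ e = 1) (f : E → ℝ)
    [Fintype (LinearMap.ker ψ)] :
    ∑ x, f x = ∑ t : k, ∑ u : LinearMap.ker ψ, f (u + t • e) := by
  rw [← Fintype.sum_prod_type' (f := fun (t : k) (u : LinearMap.ker ψ) => f (u + t • e))]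
  refine (Fintype.sum_bijective (fun z : k × LinearMap.ker ψ => (z.2 : E) + z.1 • e) ?_ _ _
    fun _ => rfl).symm
  constructor
  · rintro ⟨t, u⟩ ⟨s, v⟩ h
    have hts : t = s := by
      have := congrArg ψ h
      simpa [he] using this
    subst hts
    simpa using h
  · intro x
    refine ⟨(ψ x, ⟨x - ψ x • e, by simp [he]⟩), by simp⟩

/-- Every line sum of `f` is `0` or `1`. -/
def BinaryLineSums (k : Type*) {E : Type*} [Field k] [Fintype k] [AddCommGroup E] [Module k E]
    (f : E → ℝ) : Prop :=
  ∀ p d, d ≠ 0 → lineSum k f p d = 0 ∨ lineSum k f p d = 1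

theorem BinaryLineSums.exists_sum_eq_nat {f : E → ℝ} (hf : BinaryLineSums k f) {d : E}
    (hd : d ≠ 0) : ∃ m : ℕ, ∑ x, f x = m := by
  classical
  obtain ⟨ψ, hψ⟩ := exists_functional_eq_one (k := k) hd
  have := Fintype.ofFinite (LinearMap.ker ψ)
  refine ⟨∑ u : LinearMap.ker ψ, if lineSum k f u d = 0 then 0 else 1, ?_⟩
  rw [sum_eq_sum_ker ψ hψ f, Finset.sum_comm, Nat.cast_sum]
  refine Finset.sum_congr rfl fun u _ => ?_
  change lineSum k f u d = _
  rcases hf u d hd with h | h <;> simp [h]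

theorem BinaryLineSums.eq_zero_of_sum_eq_zero {f : E → ℝ} (hf : BinaryLineSums k f)
    (hE : Fintype.card k < Fintype.card E) (h0 : ∑ x, f x = 0) (p : E) : f p = 0 := by
  classical
  have hline : ∀ d, d ≠ 0 → lineSum k f p d = 0 := by
    intro d hd
    have hs := sum_lineSum (k := k) f d
    rw [h0, mul_zero, Finset.sum_eq_zero_iff_of_nonneg
      (fun x _ => by rcases hf x d hd with h | h <;> simp [h])] at hs
    exact hs p (Finset.mem_univ p)
  have h1 : ∑ d, lineSum k f p d = Fintype.card k * f p := by
    rw [Finset.sum_eq_single 0 (fun d _ hd => hline d hd) (by simp)]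
    simp [lineSum]
  have h2 : ∑ d, lineSum k f p d = Fintype.card E * f p := by
    unfold lineSum
    rw [Finset.sum_comm, Finset.sum_eq_single 0 ?_ (by simp)]
    · simp
    · intro t _ ht
      rw [← h0]
      exact Fintype.sum_bijective (fun d => p + t • d)
        ((Equiv.addLeft p).bijective.comp (MulAction.bijective (Units.mk0 t ht))) _ _ fun _ => rfl
  have h3 : ((Fintype.card E : ℝ) - Fintype.card k) * f p = 0 := by linarith
  refine (mul_eq_zero.1 h3).resolve_left ?_
  have : (Fintype.card k : ℝ) < Fintype.card E := by exact_mod_cast hE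
  linarith

theorem BinaryLineSums.not_const_of_sum_eq_one {f : E → ℝ} (hf : BinaryLineSums k f)
    (hE : Fintype.card k < Fintype.card E) (h1 : ∑ x, f x = 1) : ∃ x y, f x < f y := by
  by_contra! hc
  have hconst : ∀ x, f x = f 0 := fun x => le_antisymm (hc _ _) (hc _ _)
  have : Nontrivial E := Fintype.one_lt_card_iff_nontrivial.1 (lt_of_le_of_lt Fintype.card_pos hE)
  obtain ⟨d, hd⟩ := exists_ne (0 : E)
  have hl : lineSum k f 0 d = Fintype.card k * f 0 := by simp [lineSum, hconst]
  have hs : Fintype.card E * f 0 = 1 := by rw [← h1]; simp [fun x => hconst x]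
  have hE' : (Fintype.card k : ℝ) < Fintype.card E := by exact_mod_cast hE
  have hk : (0 : ℝ) < Fintype.card k := by exact_mod_cast Fintype.card_pos
  have hpos : 0 < f 0 := by
    by_contra! h
    nlinarith
  rcases hf 0 d hd with h | h <;> rw [hl] at h <;> nlinarith

theorem BinaryLineSums.not_sum_eq_two_of_binary {f : E → ℝ} (hf : BinaryLineSums k f)
    (hb : ∀ x, f x = 0 ∨ f x = 1) : ∑ x, f x ≠ 2 := by
  classical
  intro h2
  obtain ⟨x, hx⟩ : ∃ x, f x ≠ 0 := by
    by_contra! h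
    simp [h] at h2
  obtain ⟨y, hyx, hy⟩ : ∃ y, y ≠ x ∧ f y ≠ 0 := by
    by_contra! h
    rw [Finset.sum_eq_single x (fun y _ hy => h y hy) (by simp)] at h2
    rcases hb x with h | h <;> rw [h] at h2 <;> norm_num at h2
  have hle : ∑ t ∈ ({0, 1} : Finset k), f (x + t • (y - x)) ≤ lineSum k f x (y - x) :=
    Finset.sum_le_sum_of_subset_of_nonneg (Finset.subset_univ _)
      fun t _ _ => by rcases hb (x + t • (y - x)) with h | h <;> simp [h]
  rw [Finset.sum_pair zero_ne_one] at hle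
  simp [(hb x).resolve_left hx, (hb y).resolve_left hy] at hle
  rcases hf x (y - x) (sub_ne_zero.2 hyx) with h | h <;> rw [h] at hle <;> norm_num at hle

theorem BinaryLineSums.sum_ne_two {f : E → ℝ} (hf : BinaryLineSums k f)
    (hE : 3 ≤ Module.finrank k E) : ∑ x, f x ≠ 2 := by
  classical
  intro h2
  have : Nontrivial E := Module.nontrivial_of_finrank_pos (R := k) (by omega)
  obtain ⟨e, he0⟩ := exists_ne (0 : E)
  obtain ⟨ψ, he⟩ := exists_functional_eq_one (k := k) he0
  let U := LinearMap.ker ψ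
  have := Fintype.ofFinite U
  have hUrank : 2 ≤ Module.finrank k U := by
    have h := LinearMap.finrank_range_add_finrank_ker ψ
    have h' := Submodule.finrank_le (LinearMap.range ψ)
    rw [Module.finrank_self] at h'
    change _ + Module.finrank k U = _ at h
    omega
  have hU : Fintype.card k < Fintype.card U := by
    rw [Module.card_eq_pow_finrank (K := k) (V := U)]
    exact lt_self_pow₀ Fintype.one_lt_card hUrank
  have : Nontrivial U := Module.nontrivial_of_finrank_pos (R := k) (by omega)
  obtain ⟨d, hd⟩ := exists_ne (0 : U)
  have hg : ∀ c : k, BinaryLineSums k fun u : U => f (u + c • e) := by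
    intro c p d hd
    have h := hf (p + c • e) d (by simpa using hd)
    simpa [lineSum, add_right_comm] using h
  choose m hm using fun c => (hg c).exists_sum_eq_nat hd
  have hsum : ∑ c, m c = 2 := by
    have h := sum_eq_sum_ker ψ he f
    rw [h2, Finset.sum_congr rfl fun c _ => hm c] at h
    exact_mod_cast h.symm
  have hzero : ∀ c, m c = 0 → ∀ u : U, f (u + c • e) = 0 := fun c hc u =>
    (hg c).eq_zero_of_sum_eq_zero hU (by rw [hm, hc, Nat.cast_zero]) u
  obtain ⟨a, ha⟩ : ∃ a, m a ≠ 0 := by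
    by_contra! h
    simp [h] at hsum
  by_cases hb : ∃ b, b ≠ a ∧ m b ≠ 0
  · obtain ⟨b, hba, hb⟩ := hb
    have hsplit : m a + (m b + ∑ c ∈ (Finset.univ.erase a).erase b, m c) = 2 := by
      rw [Finset.add_sum_erase _ _ (by simp [hba]), Finset.add_sum_erase _ _ (by simp), hsum]
    have hma : m a = 1 := by omega
    have hmb : m b = 1 := by omega
    have hrest : ∀ c, c ≠ a → c ≠ b → m c = 0 := by
      intro c hca hcb
      have : ∑ c ∈ (Finset.univ.erase a).erase b, m c = 0 := by omega
      exact Finset.sum_eq_zero_iff.1 this c (by simp [hca, hcb])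
    have hcross : ∀ u v : U, f (u + a • e) + f (v + b • e) = 0 ∨
        f (u + a • e) + f (v + b • e) = 1 := by
      intro u v
      have hba' : b - a ≠ 0 := sub_ne_zero.2 hba
      have hd : (v - u : E) + (b - a) • e ≠ 0 := fun h => by
        have := congrArg ψ h
        simp [he, LinearMap.mem_ker.1 u.2, LinearMap.mem_ker.1 v.2, hba'] at this
      have hl : lineSum k f (u + a • e) ((v - u : E) + (b - a) • e) =
          f (u + a • e) + f (v + b • e) := by
        have hpt : ∀ t : k, (u + a • e : E) + t • ((v - u : E) + (b - a) • e) =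
            (u + t • (v - u) : U) + (a + t * (b - a)) • e := by
          intro t
          push_cast
          module
        unfold lineSum
        rw [← Finset.sum_subset (Finset.subset_univ ({0, 1} : Finset k)), Finset.sum_pair zero_ne_one]
        · simp only [hpt]
          simp
        · intro t _ ht
          simp only [Finset.mem_insert, Finset.mem_singleton, not_or] at ht
          rw [hpt]
          refine hzero _ (hrest _ ?_ ?_) _
          · simp [ht.1, hba']
          · intro h
            have : (t - 1) * (b - a) = 0 := by linear_combination h
            exact (mul_ne_zero (sub_ne_zero.2 ht.2) hba') this
      rw [← hl]
      exact hf _ _ hd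
    obtain ⟨u, u', hu⟩ := (hg a).not_const_of_sum_eq_one hU (by rw [hm, hma, Nat.cast_one])
    obtain ⟨v, v', hv⟩ := (hg b).not_const_of_sum_eq_one hU (by rw [hm, hmb, Nat.cast_one])
    rcases hcross u v with h₁ | h₁ <;> rcases hcross u v' with h₂ | h₂ <;>
      rcases hcross u' v' with h₃ | h₃ <;> linarith
  · push Not at hb
    refine hf.not_sum_eq_two_of_binary (fun x => ?_) h2
    have hx : x = ((⟨x - ψ x • e, by simp [U, he]⟩ : U) : E) + ψ x • e := by simp
    set u : U := ⟨x - ψ x • e, by simp [U, he]⟩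
    by_cases hxa : ψ x = a
    · have hl : lineSum k f u e = f x := by
        unfold lineSum
        rw [Finset.sum_eq_single a (fun c _ hc => hzero c (hb c hc) u) (by simp), ← hxa, ← hx]
      rw [← hl]
      exact hf _ _ he0
    · left
      rw [hx]
      exact hzero _ (hb _ hxa) u

end LineSums

section AffineLines

variable {F : Type} [Field F] {n : ℕ} {Hinf : Submodule F (Fin (n + 1) → F)}
  {φ : (Fin (n + 1) → F) →ₗ[F] F}
  {e : Fin (n + 1) → F}

/-- The line through the affine point `⟨e + h⟩` with point at infinity `⟨d⟩`. -/
def affLine (e : Fin (n + 1) → F) (h d : Hinf) : Submodule F (Fin (n + 1) → F) :=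
  Submodule.span F {e + h, (d : Fin (n + 1) → F)}

theorem isAffSub_affLine (hφ : LinearMap.ker φ = Hinf) (he : φ e = 1) (h : Hinf) {d : Hinf}
    (hd : d ≠ 0) : IsAffSub 1 Hinf (affLine e h d) := by
  subst hφ
  refine ⟨?_, fun hle => ?_⟩
  · have hli : LinearIndependent F ![e + h, (d : Fin (n + 1) → F)] := by
      rw [LinearIndependent.pair_iff]
      intro s t hst
      have hs : s = 0 := by simpa [he] using congrArg φ hst
      subst hs
      simpa [hd] using hst
    have := finrank_span_eq_card hli
    rwa [Matrix.range_cons, Matrix.range_cons, Matrix.range_empty, Set.union_empty,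
      Set.singleton_union, Fintype.card_fin] at this
  · have : e + h ∈ LinearMap.ker φ := hle (Submodule.subset_span (by simp))
    simp [he] at this

theorem affLine_eq_iff (hφ : LinearMap.ker φ = Hinf) (he : φ e = 1) {h d : Hinf} (hd : d ≠ 0)
    {K : Submodule F (Fin (n + 1) → F)} (hK : IsAffSub 1 Hinf K) :
    affLine e h d = K ↔ e + h ∈ K ∧ (d : Fin (n + 1) → F) ∈ K := by
  constructor
  · rintro rfl
    exact ⟨Submodule.subset_span (by simp), Submodule.subset_span (by simp)⟩
  · rintro ⟨h₁, h₂⟩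
    refine Submodule.eq_of_le_of_finrank_eq ?_ ((isAffSub_affLine hφ he h hd).1.trans hK.1.symm)
    rw [affLine, Submodule.span_le]
    simp [Set.insert_subset_iff, h₁, h₂]

theorem setOf_affPoint_le_affLine (hφ : LinearMap.ker φ = Hinf) (he : φ e = 1) (h d : Hinf) :
    {P | IsAffPoint Hinf P ∧ P ≤ affLine e h d} =
      Set.range fun t : F => Submodule.span F {e + ((h + t • d : Hinf) : Fin (n + 1) → F)} := by
  subst hφ
  have hne : ∀ x : LinearMap.ker φ, φ (e + x) = 1 := fun x => by simp [he]
  ext P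
  constructor
  · rintro ⟨⟨hP, hPH⟩, hPK⟩
    obtain ⟨v, hvP, hv⟩ := SetLike.not_le_iff_exists.1 hPH
    rw [LinearMap.mem_ker] at hv
    obtain ⟨a, b, hab⟩ := Submodule.mem_span_pair.1 (hPK hvP)
    have ha : φ v = a := by simp [← hab, he]
    rw [ha] at hv
    refine ⟨a⁻¹ * b, ?_⟩
    have hmem : e + ((h + (a⁻¹ * b) • d : LinearMap.ker φ) : Fin (n + 1) → F) ∈ P := by
      have : e + ((h + (a⁻¹ * b) • d : LinearMap.ker φ) : Fin (n + 1) → F) = a⁻¹ • v := by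
        rw [← hab]
        push_cast
        rw [smul_add, smul_smul, smul_smul, inv_mul_cancel₀ hv, one_smul, add_assoc]
      rw [this]
      exact P.smul_mem _ hvP
    refine Submodule.eq_of_le_of_finrank_eq
      ((Submodule.span_singleton_le_iff_mem _ _).2 hmem) ?_
    rw [hP, finrank_span_singleton]
    intro h0
    exact one_ne_zero (by rw [← hne (h + (a⁻¹ * b) • d), h0, map_zero] : (1 : F) = 0)
  · rintro ⟨t, rfl⟩
    refine ⟨⟨finrank_span_singleton fun h0 => ?_, fun hle => ?_⟩, ?_⟩
    · exact one_ne_zero (by rw [← hne (h + t • d), h0, map_zero] : (1 : F) = 0)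
    · have := (Submodule.span_singleton_le_iff_mem _ _).1 hle
      rw [LinearMap.mem_ker, hne] at this
      exact one_ne_zero this
    · rw [Submodule.span_singleton_le_iff_mem]
      refine Submodule.mem_span_pair.2 ⟨1, t, ?_⟩
      push_cast
      rw [one_smul, add_assoc]

theorem span_affPoint_injective (hφ : LinearMap.ker φ = Hinf) (he : φ e = 1) :
    Function.Injective fun h : Hinf => Submodule.span F {e + (h : Fin (n + 1) → F)} := by
  subst hφ
  intro h h' hh
  have hmem : e + (h : Fin (n + 1) → F) ∈ Submodule.span F {e + (h' : Fin (n + 1) → F)} := by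
    change _ = Submodule.span F {e + (h' : Fin (n + 1) → F)} at hh
    rw [← hh]
    exact Submodule.mem_span_singleton_self _
  obtain ⟨a, ha⟩ := Submodule.mem_span_singleton.1 hmem
  have h1 : a = 1 := by simpa [he] using congrArg φ ha
  subst h1
  simpa using ha.symm

theorem finsum_affLine_eq_lineSum [Fintype F] (hφ : LinearMap.ker φ = Hinf)
    (he : φ e = 1)
    (w : Submodule F (Fin (n + 1) → F) → ℝ) (h : Hinf) {d : Hinf} (hd : d ≠ 0) :
    ∑ᶠ P ∈ {P | IsAffPoint Hinf P ∧ P ≤ affLine e h d}, w P =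
      lineSum F (fun x : Hinf => w (Submodule.span F {e + (x : Fin (n + 1) → F)})) h d := by
  rw [setOf_affPoint_le_affLine hφ he, finsum_mem_range, finsum_eq_sum_of_fintype, lineSum]
  exact (span_affPoint_injective hφ he).comp
    ((add_right_injective h).comp (smul_left_injective F hd))

theorem card_affLine_fiber [Fintype F] [Fintype Hinf]
    [DecidableEq (Submodule F (Fin (n + 1) → F))] [DecidableEq Hinf] (hH : Module.finrank F Hinf = n)
    (hφ : LinearMap.ker φ = Hinf) (he : φ e = 1)
    {K : Submodule F (Fin (n + 1) → F)} (hK : IsAffSub 1 Hinf K) :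
    (Finset.univ.filter fun z : Hinf × Hinf => z.2 ≠ 0 ∧ affLine e z.1 z.2 = K).card =
      Fintype.card F * (Fintype.card F - 1) := by
  classical
  obtain ⟨v, hvK, hv⟩ := SetLike.not_le_iff_exists.1 hK.2
  have hφv : φ v ≠ 0 := by rwa [← hφ, LinearMap.mem_ker] at hv
  let h₀ : Hinf := ⟨(φ v)⁻¹ • v - e, by rw [← hφ]; simp [he, hφv]⟩
  have hh₀ : e + h₀ ∈ K := by
    simpa [h₀] using K.smul_mem (φ v)⁻¹ hvK
  have hcardK : (Finset.univ.filter fun d : Hinf => (d : Fin (n + 1) → F) ∈ K).card =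
      Fintype.card F := by
    have hrank : Module.finrank F (K.comap Hinf.subtype) = 1 := by
      have hinf : Module.finrank F (K.comap Hinf.subtype) =
          Module.finrank F (Hinf ⊓ K : Submodule F (Fin (n + 1) → F)) := by
        rw [← Submodule.map_comap_subtype]
        exact (Submodule.finrank_map_subtype_eq _ _).symm
      have hlt := Submodule.finrank_lt_finrank_of_lt (left_lt_sup.2 hK.2 : Hinf < Hinf ⊔ K)
      have hle := Submodule.finrank_le (Hinf ⊔ K)
      have hadd := Submodule.finrank_sup_add_finrank_inf_eq Hinf K
      rw [Module.finrank_fin_fun] at hle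
      have := hK.1
      omega
    have := Module.card_eq_pow_finrank (K := F) (V := K.comap Hinf.subtype)
    rw [hrank, pow_one] at this
    rw [← this, Fintype.card_subtype]
    rfl
  have hcardPt : (Finset.univ.filter fun h : Hinf => e + (h : Fin (n + 1) → F) ∈ K).card =
      Fintype.card F := by
    rw [← hcardK]
    refine Finset.card_equiv (Equiv.subRight h₀) fun h => ?_
    simp only [Finset.mem_filter, Finset.mem_univ, true_and, Equiv.subRight_apply]
    rw [← K.add_mem_iff_left hh₀ (x := ((h - h₀ : Hinf) : Fin (n + 1) → F))]
    push_cast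
    rw [show (h - h₀ + (e + h₀) : Fin (n + 1) → F) = e + h by abel]
  have hprod : (Finset.univ.filter fun z : Hinf × Hinf => z.2 ≠ 0 ∧ affLine e z.1 z.2 = K) =
      (Finset.univ.filter fun h : Hinf => e + (h : Fin (n + 1) → F) ∈ K) ×ˢ
        (Finset.univ.filter fun d : Hinf => (d : Fin (n + 1) → F) ∈ K).erase 0 := by
    ext ⟨h, d⟩
    by_cases hd : d = 0
    · simp [hd]
    · simp [hd, affLine_eq_iff hφ he hd hK]
  rw [hprod, Finset.card_product, hcardPt, Finset.card_erase_of_mem (by simp), hcardK]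

theorem sum_weight_eq [Fintype F] [Fintype Hinf] (hH : Module.finrank F Hinf = n)
    (hφ : LinearMap.ker φ = Hinf) (he : φ e = 1)
    {L : Set (Submodule F (Fin (n + 1) → F))} (hL : ∀ K ∈ L, IsAffSub 1 Hinf K) {f : Hinf → ℝ}
    (hf : ∀ h d : Hinf, d ≠ 0 → lineSum F f h d = L.indicator (fun _ => 1) (affLine e h d)) :
    ((Fintype.card F : ℝ) ^ n - 1) * ∑ x, f x = (L.ncard : ℝ) * (Fintype.card F - 1) := by
  classical
  have := Fintype.ofFinite L
  have hcard : Fintype.card Hinf = Fintype.card F ^ n := by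
    rw [Module.card_eq_pow_finrank (K := F), hH]
  have hq : (Fintype.card F : ℝ) ≠ 0 := by exact_mod_cast Fintype.card_ne_zero
  have hleft : ∑ d ∈ Finset.univ.erase (0 : Hinf), ∑ h, lineSum F f h d =
      (Fintype.card F ^ n - 1) * (Fintype.card F * ∑ x, f x) := by
    simp only [sum_lineSum, Finset.sum_const, nsmul_eq_mul]
    rw [Finset.card_erase_of_mem (Finset.mem_univ _), Finset.card_univ, hcard,
      Nat.cast_sub (Nat.one_le_pow _ _ Fintype.card_pos)]
    simp
  have hright : ∑ d ∈ Finset.univ.erase (0 : Hinf), ∑ h, lineSum F f h d =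
      L.ncard * (Fintype.card F * (Fintype.card F - 1)) := by
    have hS : ∑ d ∈ Finset.univ.erase (0 : Hinf), ∑ h, lineSum F f h d =
        ((Finset.univ.filter fun z : Hinf × Hinf =>
          z.2 ≠ 0 ∧ affLine e z.1 z.2 ∈ L.toFinset).card : ℝ) := by
      rw [Finset.sum_comm, ← Finset.sum_product', Finset.card_filter, Nat.cast_sum,
        ← Finset.sum_subset (Finset.subset_univ (Finset.univ ×ˢ Finset.univ.erase (0 : Hinf)))]
      · refine Finset.sum_congr rfl fun z hz => ?_
        have hz' : z.2 ≠ 0 := by simpa using hz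
        rw [hf _ _ hz']
        simp [hz', Set.indicator_apply]
      · intro z _ hz
        have hz' : z.2 = 0 := by simpa using hz
        simp [hz']
    rw [hS, Finset.card_eq_sum_card_fiberwise (f := fun z => affLine e z.1 z.2) (t := L.toFinset)
      (fun z hz => (Finset.mem_filter.1 hz).2.2),
      Finset.sum_congr rfl (g := fun _ => Fintype.card F * (Fintype.card F - 1)) ?_]
    · rw [Finset.sum_const, ← Set.ncard_eq_toFinset_card', smul_eq_mul]
      push_cast [Nat.cast_sub (Fintype.card_pos (α := F))]
      simp
    · intro K hK
      rw [← card_affLine_fiber hH hφ he (hL K (by simpa using hK)), Finset.filter_filter]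
      congr 1
      refine Finset.filter_congr fun z _ => ?_
      constructor
      · rintro ⟨⟨h₁, -⟩, h₂⟩
        exact ⟨h₁, h₂⟩
      · rintro ⟨h₁, h₂⟩
        exact ⟨⟨h₁, h₂ ▸ hK⟩, h₂⟩
  refine mul_left_cancel₀ hq ?_
  linear_combination hright - hleft

end AffineLines

theorem statement13 (q : ℕ) (hq : IsPrimePow q) (hF : Fintype.card F = q)
    (hn : 3 ≤ n)
    (Hinf : Submodule F (Fin (n + 1) → F)) (hH : Module.finrank F Hinf = n) :
    ¬ ∃ L : Set (Submodule F (Fin (n + 1) → F)),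
      IsCLAff 1 Hinf L ∧ (L.ncard : ℚ) = 2 * gaussBinom q n 1 := by
  rintro ⟨L, ⟨hL, w, hw⟩, hcard⟩
  have := Fintype.ofFinite Hinf
  obtain ⟨φ, e, hφ, he⟩ := exists_functional_ker_eq hH
  have hf : ∀ h d : Hinf, d ≠ 0 →
      lineSum F (fun x : Hinf => w (Submodule.span F {e + (x : Fin (n + 1) → F)})) h d =
        L.indicator (fun _ => 1) (affLine e h d) := fun h d hd => by
    rw [hw _ (isAffSub_affLine hφ he h hd), finsum_affLine_eq_lineSum hφ he w h hd]
  have hbin : BinaryLineSums F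
      fun x : Hinf => w (Submodule.span F {e + (x : Fin (n + 1) → F)}) := fun h d hd => by
    rw [hf h d hd]
    exact Set.indicator_eq_zero_or_self L (fun _ => (1 : ℝ)) _
  refine hbin.sum_ne_two (hn.trans_eq hH.symm) ?_
  have hsum := sum_weight_eq hH hφ he hL hf
  have hq1 : (1 : ℝ) < q := by exact_mod_cast hq.one_lt
  have hqn : (1 : ℝ) < (q : ℝ) ^ n := one_lt_pow₀ hq1 (by omega)
  have hcard' : (L.ncard : ℝ) = 2 * (((q : ℝ) ^ n - 1) / (q - 1)) := by
    have := congrArg (Rat.cast : ℚ → ℝ) hcard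
    simpa [gaussBinom] using this
  rw [hF, hcard', mul_assoc, div_mul_cancel₀ _ (by linarith)] at hsum
  exact mul_left_cancel₀ (sub_ne_zero.2 hqn.ne') (by linarith)
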